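/- Let X and Z be independent ℝ^d-valued random vectors with densities, let C be a standard d-dimensional isotropic Cauchy vector independent of (X, Z), and assume that h(X), h(X+Z), h(X+tC) and h(X+Z+tC) are finite for all sufficiently small t > 0 and that the limits J₁(X) = lim_{t→0⁺}(h(X+tC) − h(X))/t and J₁(X+Z) = lim_{t→0⁺}(h(X+Z+tC) − h(X+Z))/t both exist and are finite. Then J₁(X+Z) ≤ J₁(X). (This is Property (6) of the paper's α-Fisher information at α = 1: adding an independent random vector cannot increase the α-Fisher information.) -/

import Mathlib

open MeasureTheory ProbabilityTheory Real Filter Topology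

/-- The standard `d`-dimensional isotropic Cauchy density. -/
noncomputable def pC (d : ℕ) (x : EuclideanSpace ℝ (Fin d)) : ℝ :=
  Real.Gamma (((d : ℝ) + 1) / 2) * Real.pi ^ (-((d : ℝ) + 1) / 2) *
    (1 + ‖x‖ ^ 2) ^ (-((d : ℝ) + 1) / 2)


/-- A real function whose positive part is a (possibly non-measurable) density agrees, after
composition with a continuous `φ`, with a genuine measurable density off the zero set of the
latter, as soon as `φ ∘ q` is measurable. -/
theorem exists_measurable_density {α : Type*} [MeasurableSpace α] {ν : Measure α} [SigmaFinite ν]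
    {q : α → ℝ} {φ : ℝ → ℝ} (hφ : Continuous φ) (hm : AEMeasurable (fun x => φ (q x)) ν) :
    ∃ f : α → ℝ, Measurable f ∧ (∀ x, 0 ≤ f x) ∧
      ν.withDensity (fun x => ENNReal.ofReal (q x)) =
        ν.withDensity (fun x => ENNReal.ofReal (f x)) ∧
      ∀ᵐ x ∂ν, f x ≠ 0 → φ (f x) = φ (q x) := by
  obtain ⟨g, hg, hgq, hgd⟩ := exists_measurable_le_withDensity_eq ν (fun x => ENNReal.ofReal (q x))
  have hgtop : ∀ x, g x ≠ ⊤ := fun x => ((hgq x).trans_lt ENNReal.ofReal_lt_top).ne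
  refine ⟨fun x => (g x).toReal, hg.ennreal_toReal, fun x => ENNReal.toReal_nonneg, ?_, ?_⟩
  · simp only [ENNReal.ofReal_toReal (hgtop _)]
    exact hgd.symm
  set ψ := hm.mk _ with hψ
  let S : ℚ → ℚ → Set α := fun a b =>
    {x | g x ≠ 0 ∧ (a : ℝ) < (g x).toReal ∧ (g x).toReal < b ∧ ψ x ∉ φ '' Set.Icc (a : ℝ) b}
  have hS : ∀ a b, MeasurableSet (S a b) := by
    intro a b
    have h1 : MeasurableSet (φ '' Set.Icc (a : ℝ) b) :=
      (isCompact_Icc.image hφ).isClosed.measurableSet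
    exact ((hg (measurableSet_singleton 0)).compl).inter
      ((measurableSet_lt measurable_const hg.ennreal_toReal).inter
      ((measurableSet_lt hg.ennreal_toReal measurable_const).inter
        (hm.measurable_mk h1).compl))
  have hnull : ∀ a b, ∀ᵐ x ∂ν, x ∉ S a b := by
    intro a b
    classical
    let k : α → ENNReal := (S a b).piecewise (fun _ => ENNReal.ofReal b) g
    have hk : Measurable k := Measurable.piecewise (hS a b) measurable_const hg
    have hkq : ∀ᵐ x ∂ν, k x ≤ ENNReal.ofReal (q x) := by
      filter_upwards [hm.ae_eq_mk] with x hx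
      by_cases hxS : x ∈ S a b
      · simp only [k, Set.piecewise_eq_of_mem _ _ _ hxS]
        obtain ⟨h0, h1, h2, h3⟩ := hxS
        have h4 : (g x).toReal ≤ q x := by
          have h5 : 0 < q x := by
            by_contra hneg
            have := hgq x
            simp only [ENNReal.ofReal_of_nonpos (not_lt.1 hneg)] at this
            exact h0 (le_antisymm this bot_le)
          exact ENNReal.toReal_le_of_le_ofReal h5.le (hgq x)
        apply ENNReal.ofReal_le_ofReal
        by_contra hlt
        exact h3 ⟨q x, ⟨(h1.trans_le h4).le, (not_le.1 hlt).le⟩, hx⟩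
      · simp only [k, Set.piecewise_eq_of_notMem _ _ _ hxS]
        exact hgq x
    have hkg : k ≤ᵐ[ν] g := by
      refine ae_le_of_forall_setLIntegral_le_of_sigmaFinite hk fun s hs _ => ?_
      calc ∫⁻ x in s, k x ∂ν ≤ ∫⁻ x in s, ENNReal.ofReal (q x) ∂ν :=
            lintegral_mono_ae (ae_restrict_of_ae hkq)
        _ = ∫⁻ x in s, g x ∂ν := by
            rw [← withDensity_apply _ hs, ← withDensity_apply _ hs, hgd]
    filter_upwards [hkg] with x hx hxS
    simp only [k, Set.piecewise_eq_of_mem _ _ _ hxS] at hx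
    have := (ENNReal.ofReal_le_iff_le_toReal (hgtop x)).1 hx
    exact absurd hxS.2.2.1 (not_lt.2 this)
  have hnull' : ∀ᵐ x ∂ν, ∀ a b, x ∉ S a b := by
    rw [ae_all_iff]; intro a; rw [ae_all_iff]; exact hnull a
  filter_upwards [hnull', hm.ae_eq_mk] with x hx hxψ hne
  by_contra hφne
  have hopen : {u | φ u ≠ φ (q x)} ∈ 𝓝 (g x).toReal :=
    (isOpen_ne.preimage hφ).mem_nhds hφne
  obtain ⟨ε, hε, hball⟩ := Metric.mem_nhds_iff.1 hopen
  obtain ⟨a, ha1, ha2⟩ := exists_rat_btwn (sub_lt_self (g x).toReal hε)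
  obtain ⟨b, hb1, hb2⟩ := exists_rat_btwn (lt_add_of_pos_right (g x).toReal hε)
  refine hx a b ⟨fun h => hne (by simp [h]), ha2, hb1, ?_⟩
  rintro ⟨u, ⟨hu1, hu2⟩, hu⟩
  have hmem : u ∈ Metric.ball (g x).toReal ε := by
    rw [Metric.mem_ball, Real.dist_eq, abs_lt]
    constructor <;> linarith
  exact hball hmem (by rw [hu, hψ, ← hxψ])

/-- Jensen's inequality for the logarithm, in the form `E log U ≤ E U - 1`. -/
theorem integral_log_le_of_lintegral_le {Ω : Type*} [MeasurableSpace Ω] {μ : Measure Ω}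
    [IsProbabilityMeasure μ] {U : Ω → ℝ} (hU : AEMeasurable U μ) (hpos : ∀ᵐ ω ∂μ, 0 < U ω)
    (hlog : Integrable (fun ω => Real.log (U ω)) μ) {m : ℝ} (hm : 0 ≤ m)
    (h : ∫⁻ ω, ENNReal.ofReal (U ω) ∂μ ≤ ENNReal.ofReal m) :
    ∫ ω, Real.log (U ω) ∂μ ≤ m - 1 := by
  have hnn : 0 ≤ᵐ[μ] U := hpos.mono fun _ h => h.le
  have hint : Integrable U μ :=
    (lintegral_ofReal_ne_top_iff_integrable hU.aestronglyMeasurable hnn).1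
      (h.trans_lt ENNReal.ofReal_lt_top).ne
  have h1 : ∫ ω, U ω ∂μ ≤ m := by
    rw [← ofReal_integral_eq_lintegral_ofReal hint hnn] at h
    exact (ENNReal.ofReal_le_ofReal_iff hm).1 h
  calc ∫ ω, Real.log (U ω) ∂μ ≤ ∫ ω, (U ω - 1) ∂μ :=
        integral_mono_ae hlog (hint.sub (integrable_const 1))
          (hpos.mono fun ω hω => Real.log_le_sub_one_of_pos hω)
    _ = ∫ ω, U ω ∂μ - 1 := by rw [integral_sub hint (integrable_const 1)]; simp
    _ ≤ m - 1 := by linarith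

section Density

variable {Ω : Type*} [MeasurableSpace Ω] {μ : Measure Ω}
  {E : Type*} [NormedAddCommGroup E] [InnerProductSpace ℝ E] [FiniteDimensional ℝ E]
  [MeasurableSpace E] [BorelSpace E]

/-- `f` is a density of the random vector `Y` for which the differential entropy is finite. -/
structure IsEntropyDensity (f : E → ℝ) (Y : Ω → E) (μ : Measure Ω) : Prop where
  measurable : Measurable f
  nonneg : ∀ x, 0 ≤ f x
  map_eq : μ.map Y = volume.withDensity (fun x => ENNReal.ofReal (f x))
  integrable : Integrable (fun x => f x * Real.log (f x))

theorem exists_isEntropyDensity {q : E → ℝ} {Y : Ω → E}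
    (hq : μ.map Y = volume.withDensity (fun x => ENNReal.ofReal (q x)))
    (hint : Integrable (fun x => q x * Real.log (q x))) :
    ∃ f, IsEntropyDensity f Y μ ∧
      ∀ᵐ x, f x ≠ 0 → f x * Real.log (f x) = q x * Real.log (q x) := by
  obtain ⟨f, hf, hf0, hd, hae⟩ :=
    exists_measurable_density Real.continuous_mul_log hint.1.aemeasurable
  refine ⟨f, ⟨hf, hf0, hq.trans hd, ?_⟩, hae⟩
  refine hint.mono (hf.mul (Real.measurable_log.comp hf)).aestronglyMeasurable ?_
  filter_upwards [hae] with x hx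
  by_cases h0 : f x = 0
  · simpa [h0] using mul_nonneg (abs_nonneg (q x)) (abs_nonneg (Real.log (q x)))
  · rw [hx h0]

namespace IsEntropyDensity

variable {f : E → ℝ} {Y : Ω → E}

theorem lintegral_comp (h : IsEntropyDensity f Y μ) (hY : Measurable Y) {k : E → ENNReal}
    (hk : Measurable k) :
    ∫⁻ ω, k (Y ω) ∂μ = ∫⁻ x, ENNReal.ofReal (f x) * k x := by
  rw [← lintegral_map hk hY, h.map_eq,
    lintegral_withDensity_eq_lintegral_mul _ h.measurable.ennreal_ofReal hk]
  rfl

theorem ae_pos (h : IsEntropyDensity f Y μ) (hY : Measurable Y) : ∀ᵐ ω ∂μ, 0 < f (Y ω) := by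
  have : ∀ᵐ x ∂(μ.map Y), 0 < f x := by
    rw [h.map_eq, ae_withDensity_iff h.measurable.ennreal_ofReal]
    exact ae_of_all _ fun x hx => by simpa using hx
  exact ae_of_ae_map hY.aemeasurable this

theorem integrable_log (h : IsEntropyDensity f Y μ) (hY : Measurable Y) :
    Integrable (fun ω => Real.log (f (Y ω))) μ := by
  have : Integrable (fun x => Real.log (f x)) (μ.map Y) := by
    rw [h.map_eq, integrable_withDensity_iff_integrable_smul' h.measurable.ennreal_ofReal
      (ae_of_all _ fun _ => ENNReal.ofReal_lt_top)]
    simpa only [ENNReal.toReal_ofReal (h.nonneg _), smul_eq_mul] using h.integrable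
  exact this.comp_measurable hY

theorem integral_log (h : IsEntropyDensity f Y μ) (hY : Measurable Y) :
    ∫ ω, Real.log (f (Y ω)) ∂μ = ∫ x, f x * Real.log (f x) := by
  rw [← integral_map (f := fun x => Real.log (f x)) hY.aemeasurable
    (Real.measurable_log.comp h.measurable).aestronglyMeasurable, h.map_eq,
    integral_withDensity_eq_integral_toReal_smul h.measurable.ennreal_ofReal
      (ae_of_all _ fun _ => ENNReal.ofReal_lt_top)]
  simp only [ENNReal.toReal_ofReal (h.nonneg _), smul_eq_mul]

theorem ae_pos_of_absolutelyContinuous (h : IsEntropyDensity f Y μ) (hac : volume ≪ μ.map Y) :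
    ∀ᵐ x, 0 < f x := by
  refine hac.ae_le ?_
  rw [h.map_eq]
  exact (ae_withDensity_iff h.measurable.ennreal_ofReal).2
    (ae_of_all _ fun x hx => by simpa using hx)

theorem lintegral_eq_one [IsProbabilityMeasure μ] (h : IsEntropyDensity f Y μ)
    (hY : Measurable Y) : ∫⁻ x, ENNReal.ofReal (f x) = 1 := by
  simpa using (h.lintegral_comp hY (k := fun _ => 1) measurable_const).symm

/-- Gibbs' inequality. -/
theorem integral_log_le [IsProbabilityMeasure μ] (h : IsEntropyDensity f Y μ) (hY : Measurable Y)
    {ρ : E → ℝ} (hρ : Measurable ρ) (hpos : ∀ x, 0 < ρ x)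
    (hlog : Integrable (fun ω => Real.log (ρ (Y ω))) μ) {m : ℝ} (hm : 0 ≤ m)
    (hle : ∫⁻ x, ENNReal.ofReal (ρ x) ≤ ENNReal.ofReal m) :
    ∫ ω, Real.log (ρ (Y ω)) ∂μ - ∫ ω, Real.log (f (Y ω)) ∂μ ≤ m - 1 := by
  have hfY := h.ae_pos hY
  have heq : (fun ω => Real.log (ρ (Y ω)) - Real.log (f (Y ω))) =ᵐ[μ]
      fun ω => Real.log (ρ (Y ω) / f (Y ω)) := by
    filter_upwards [hfY] with ω hω
    rw [Real.log_div (hpos _).ne' hω.ne']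
  rw [← integral_sub hlog (h.integrable_log hY), integral_congr_ae heq]
  have hmeas : Measurable fun x => ρ x / f x := hρ.div h.measurable
  refine integral_log_le_of_lintegral_le (hmeas.comp hY).aemeasurable
    (hfY.mono fun ω hω => div_pos (hpos _) hω)
    ((hlog.sub (h.integrable_log hY)).congr heq) hm (le_trans ?_ hle)
  refine (h.lintegral_comp hY (k := fun x => ENNReal.ofReal (ρ x / f x))
    hmeas.ennreal_ofReal).trans_le ?_
  refine lintegral_mono fun x => ?_
  rw [← ENNReal.ofReal_mul (h.nonneg x)]
  refine ENNReal.ofReal_le_ofReal ?_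
  rcases (h.nonneg x).eq_or_lt with h0 | h0
  · simp [← h0, (hpos x).le]
  · rw [mul_div_cancel₀ _ h0.ne']

end IsEntropyDensity

theorem lintegral_comp_of_indepFun [IsProbabilityMeasure μ] {α β : Type*} [MeasurableSpace α]
    [MeasurableSpace β] {A : Ω → α} {B : Ω → β} (hA : Measurable A) (hB : Measurable B)
    (hAB : IndepFun A B μ) {k : α × β → ENNReal} (hk : Measurable k) :
    ∫⁻ ω, k (A ω, B ω) ∂μ = ∫⁻ ω', ∫⁻ ω, k (A ω, B ω') ∂μ ∂μ := by
  have : IsProbabilityMeasure (μ.map A) := Measure.isProbabilityMeasure_map hA.aemeasurable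
  have : IsProbabilityMeasure (μ.map B) := Measure.isProbabilityMeasure_map hB.aemeasurable
  rw [← lintegral_map (f := k) hk (hA.prodMk hB),
    (indepFun_iff_map_prod_eq_prod_map_map hA.aemeasurable hB.aemeasurable).1 hAB,
    lintegral_prod_symm' _ hk, lintegral_map hk.lintegral_prod_left' hB]
  refine lintegral_congr fun ω' => ?_
  exact lintegral_map (f := fun x => k (x, B ω')) (hk.comp measurable_prodMk_right) hA

theorem IsEntropyDensity.lintegral_comp_of_indepFun [IsProbabilityMeasure μ] {β : Type*}
    [MeasurableSpace β] {f : E → ℝ} {A : Ω → E} {B : Ω → β} (h : IsEntropyDensity f A μ)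
    (hA : Measurable A) (hB : Measurable B) (hAB : IndepFun A B μ)
    {k : E × β → ENNReal} (hk : Measurable k) :
    ∫⁻ ω, k (A ω, B ω) ∂μ = ∫⁻ ω, ∫⁻ x, ENNReal.ofReal (f x) * k (x, B ω) ∂volume ∂μ := by
  rw [_root_.lintegral_comp_of_indepFun hA hB hAB hk]
  exact lintegral_congr fun ω => h.lintegral_comp hA (hk.comp measurable_prodMk_right)

/-- If `T` is distributed as the sum of `B` and an independent vector with density `a`, then the
convolution of `a` with the law of `B` is a density of `T`. -/
theorem map_eq_withDensity_of_lintegral [IsProbabilityMeasure μ] {T B : Ω → E} (hT : Measurable T)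
    (hB : Measurable B) {a : E → ENNReal} (ha : Measurable a)
    (h : ∀ k : E → ENNReal, Measurable k →
      ∫⁻ ω, k (T ω) ∂μ = ∫⁻ ω, ∫⁻ x, a x * k (x + B ω) ∂volume ∂μ) :
    μ.map T = volume.withDensity (fun y => ∫⁻ ω, a (y - B ω) ∂μ) := by
  ext s hs
  rw [withDensity_apply _ hs, ← lintegral_indicator_one hs,
    lintegral_map (measurable_one.indicator hs) hT, h _ (measurable_one.indicator hs)]
  have h1 : ∀ ω, ∫⁻ x, a x * s.indicator 1 (x + B ω) =
      ∫⁻ y, a (y - B ω) * s.indicator 1 y := fun ω => by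
    rw [← lintegral_add_right_eq_self (fun y => a (y - B ω) * s.indicator 1 y) (B ω)]
    simp
  simp_rw [h1]
  rw [lintegral_lintegral_swap, ← lintegral_indicator hs]
  · refine lintegral_congr fun y => ?_
    by_cases hy : y ∈ s <;> simp [hy]
  · exact ((ha.comp (measurable_snd.sub (hB.comp measurable_fst))).mul
      ((measurable_one.indicator hs).comp measurable_snd)).aemeasurable

theorem volume_absolutelyContinuous_map_add [IsProbabilityMeasure μ] {A B : Ω → E}
    (hA : Measurable A) (hB : Measurable B) (hAB : IndepFun A B μ) (hac : volume ≪ μ.map A) :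
    volume ≪ μ.map (fun ω => B ω + A ω) := by
  refine Measure.AbsolutelyContinuous.mk fun s hs h0 => ?_
  have hind : Measurable (s.indicator (1 : E → ENNReal)) := measurable_one.indicator hs
  rw [← lintegral_indicator_one hs, lintegral_map hind (by fun_prop),
    lintegral_comp_of_indepFun (k := fun p : E × E => s.indicator 1 (p.2 + p.1)) hA hB hAB
      (hind.comp (measurable_snd.add measurable_fst)),
    lintegral_eq_zero_iff] at h0
  · obtain ⟨b, hb⟩ : ∃ b : E, ∫⁻ ω, s.indicator (1 : E → ENNReal) (b + A ω) ∂μ = 0 := by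
      obtain ⟨ω, hω⟩ := h0.exists
      exact ⟨B ω, hω⟩
    have hind' : Measurable fun x => s.indicator (1 : E → ENNReal) (b + x) :=
      hind.comp (measurable_const.add measurable_id)
    have hpre : MeasurableSet ((fun x => b + x) ⁻¹' s) :=
      (measurable_const.add measurable_id) hs
    have : μ.map A ((fun x => b + x) ⁻¹' s) = 0 := by
      rw [← lintegral_indicator_one hpre, ← hb, lintegral_map (measurable_one.indicator hpre) hA]
      rfl
    have := hac this
    rwa [measure_preimage_add] at this
  · exact (hind.comp ((hB.comp measurable_snd).add (hA.comp measurable_fst))).lintegral_prod_left'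

theorem volume_absolutelyContinuous_map_smul {A : Ω → E} (hA : Measurable A)
    (hac : volume ≪ μ.map A) {t : ℝ} (ht : t ≠ 0) :
    volume ≪ μ.map (fun ω => t • A ω) := by
  refine Measure.AbsolutelyContinuous.mk fun s hs h0 => ?_
  have hpre : MeasurableSet ((fun x : E => t • x) ⁻¹' s) := measurable_const_smul t hs
  have h1 : μ.map A ((fun x : E => t • x) ⁻¹' s) = 0 := by
    rw [Measure.map_apply hA hpre]
    rwa [Measure.map_apply (by fun_prop) hs] at h0
  have h2 := hac h1
  rw [Measure.addHaar_preimage_smul _ ht] at h2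
  refine (mul_eq_zero.1 h2).resolve_left ?_
  simp [ht]

/-- Adding an independent vector does not decrease the differential entropy. -/
theorem integral_log_add_le [IsProbabilityMeasure μ] {Y W : Ω → E} (hY : Measurable Y)
    (hW : Measurable W) (hYW : IndepFun Y W μ) {f g : E → ℝ} (hf : IsEntropyDensity f Y μ)
    (hg : IsEntropyDensity g (fun ω => Y ω + W ω) μ) :
    ∫ x, g x * Real.log (g x) ≤ ∫ x, f x * Real.log (f x) := by
  have hS : Measurable fun ω => Y ω + W ω := hY.add hW
  rw [← hf.integral_log hY, ← hg.integral_log hS, ← sub_nonpos,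
    ← integral_sub (hg.integrable_log hS) (hf.integrable_log hY)]
  have heq : (fun ω => Real.log (g (Y ω + W ω)) - Real.log (f (Y ω))) =ᵐ[μ]
      fun ω => Real.log (g (Y ω + W ω) / f (Y ω)) := by
    filter_upwards [hf.ae_pos hY, hg.ae_pos hS] with ω h1 h2
    rw [Real.log_div h2.ne' h1.ne']
  rw [integral_congr_ae heq]
  have hmeas : Measurable fun p : E × E => g (p.1 + p.2) / f p.1 :=
    (hg.measurable.comp (measurable_fst.add measurable_snd)).div
      (hf.measurable.comp measurable_fst)
  refine (integral_log_le_of_lintegral_le (m := 1) (hmeas.comp (hY.prodMk hW)).aemeasurable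
    ?_ (((hg.integrable_log hS).sub (hf.integrable_log hY)).congr heq) zero_le_one ?_).trans_eq
    (sub_self 1)
  · filter_upwards [hf.ae_pos hY, hg.ae_pos hS] with ω h1 h2
    exact div_pos h2 h1
  calc ∫⁻ ω, ENNReal.ofReal (g (Y ω + W ω) / f (Y ω)) ∂μ
      = ∫⁻ ω, ∫⁻ x, ENNReal.ofReal (f x) * ENNReal.ofReal (g (x + W ω) / f x) ∂volume ∂μ :=
        hf.lintegral_comp_of_indepFun hY hW hYW hmeas.ennreal_ofReal
    _ ≤ ∫⁻ ω, ∫⁻ x, ENNReal.ofReal (g (x + W ω)) ∂volume ∂μ := by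
        refine lintegral_mono fun ω => lintegral_mono fun x => ?_
        rw [← ENNReal.ofReal_mul (hf.nonneg x)]
        refine ENNReal.ofReal_le_ofReal ?_
        rcases (hf.nonneg x).eq_or_lt with h0 | h0
        · simp [← h0, hg.nonneg]
        · rw [mul_div_cancel₀ _ h0.ne']
    _ = ENNReal.ofReal 1 := by
        simp_rw [lintegral_add_right_eq_self (fun x => ENNReal.ofReal (g x)),
          hg.lintegral_eq_one hS]
        simp

/-- The data processing inequality for mutual information: the entropy gained by adding `W` to
`X + Z` is at most the entropy gained by adding `W` to `X`. -/
theorem integral_log_sub_le [IsProbabilityMeasure μ] {X Z W : Ω → E} (hX : Measurable X)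
    (hZ : Measurable Z) (hW : Measurable W) (hXZ : IndepFun X Z μ)
    (hXZW : IndepFun (fun ω => (X ω, Z ω)) W μ) {f g r s : E → ℝ}
    (hf : IsEntropyDensity f X μ) (hg : IsEntropyDensity g (fun ω => X ω + W ω) μ)
    (hr : IsEntropyDensity r (fun ω => X ω + Z ω) μ)
    (hs : IsEntropyDensity s (fun ω => X ω + Z ω + W ω) μ) :
    (∫ x, r x * Real.log (r x)) - ∫ x, s x * Real.log (s x) ≤
      (∫ x, f x * Real.log (f x)) - ∫ x, g x * Real.log (g x) := by
  have hXW : Measurable fun ω => X ω + W ω := hX.add hW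
  have hXZ' : Measurable fun ω => X ω + Z ω := hX.add hZ
  have hS : Measurable fun ω => X ω + Z ω + W ω := hXZ'.add hW
  -- the law of the triple
  have htriple : ∀ k : E × E × E → ENNReal, Measurable k →
      ∫⁻ ω, k (X ω, Z ω, W ω) ∂μ =
        ∫⁻ ω', ∫⁻ ω, ∫⁻ x, ENNReal.ofReal (f x) * k (x, Z ω, W ω') ∂volume ∂μ ∂μ := by
    intro k hk
    rw [lintegral_comp_of_indepFun (k := fun p : (E × E) × E => k (p.1.1, p.1.2, p.2))
      (hX.prodMk hZ) hW hXZW (hk.comp (by fun_prop))]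
    refine lintegral_congr fun ω' => ?_
    exact hf.lintegral_comp_of_indepFun (k := fun p : E × E => k (p.1, p.2, W ω')) hX hZ hXZ
      (hk.comp (by fun_prop))
  have hXiW : IndepFun X W μ := hXZW.comp measurable_fst measurable_id
  -- the density of the triple sum as a convolution
  have hconv : ∀ᵐ y, ENNReal.ofReal (s y) = ∫⁻ ω, ENNReal.ofReal (g (y - Z ω)) ∂μ := by
    have hgm : Measurable fun y => ∫⁻ ω, ENNReal.ofReal (g (y - Z ω)) ∂μ :=
      (hg.measurable.ennreal_ofReal.comp (measurable_snd.sub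
        (hZ.comp measurable_fst))).lintegral_prod_left' (f := fun p : Ω × E =>
          ENNReal.ofReal (g (p.2 - Z p.1)))
    have := map_eq_withDensity_of_lintegral (μ := μ) hS hZ hg.measurable.ennreal_ofReal
      (fun k hk => by
        have h1 := htriple (fun p => k (p.1 + p.2.1 + p.2.2)) (hk.comp (by fun_prop))
        simp only at h1
        rw [h1, lintegral_lintegral_swap]
        · refine lintegral_congr fun ω => ?_
          have hk' : Measurable fun y => k (y + Z ω) := hk.comp (measurable_id.add_const _)
          rw [← hg.lintegral_comp hXW hk',
            hf.lintegral_comp_of_indepFun (k := fun p : E × E => k (p.1 + p.2 + Z ω)) hX hW hXiW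
              (hk.comp (by fun_prop))]
          simp_rw [add_right_comm]
        · have hm : Measurable fun p : (Ω × Ω) × E =>
              ENNReal.ofReal (f p.2) * k (p.2 + Z p.1.2 + W p.1.1) :=
            (hf.measurable.comp measurable_snd).ennreal_ofReal.mul (hk.comp (by fun_prop))
          exact hm.lintegral_prod_right'.aemeasurable)
    rw [hs.map_eq] at this
    refine (withDensity_eq_iff hs.measurable.ennreal_ofReal.aemeasurable hgm.aemeasurable ?_).1 this
    rw [hs.lintegral_eq_one hS]
    exact ENNReal.one_ne_top
  have hpos : ∀ᵐ ω ∂μ, 0 < f (X ω) ∧ 0 < g (X ω + W ω) ∧ 0 < r (X ω + Z ω) ∧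
      0 < s (X ω + Z ω + W ω) := by
    filter_upwards [hf.ae_pos hX, hg.ae_pos hXW, hr.ae_pos hXZ', hs.ae_pos hS] with ω h1 h2 h3 h4
    exact ⟨h1, h2, h3, h4⟩
  have i1 := hf.integrable_log hX
  have i2 := hg.integrable_log hXW
  have i3 := hr.integrable_log hXZ'
  have i4 := hs.integrable_log hS
  let U : E × E × E → ℝ := fun p =>
    g (p.1 + p.2.2) * r (p.1 + p.2.1) / (s (p.1 + p.2.1 + p.2.2) * f p.1)
  have hU : Measurable U := by
    have := hf.measurable
    have := hg.measurable
    have := hr.measurable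
    have := hs.measurable
    fun_prop
  have heq : (fun ω => (Real.log (g (X ω + W ω)) + Real.log (r (X ω + Z ω))) -
      (Real.log (s (X ω + Z ω + W ω)) + Real.log (f (X ω)))) =ᵐ[μ]
      fun ω => Real.log (U (X ω, Z ω, W ω)) := by
    filter_upwards [hpos] with ω ⟨h1, h2, h3, h4⟩
    rw [Real.log_div (mul_pos h2 h3).ne' (mul_pos h4 h1).ne', Real.log_mul h2.ne' h3.ne',
      Real.log_mul h4.ne' h1.ne']
  have key : ∫ ω, Real.log (U (X ω, Z ω, W ω)) ∂μ ≤ 1 - 1 := by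
    refine integral_log_le_of_lintegral_le (hU.comp (hX.prodMk (hZ.prodMk hW))).aemeasurable
      ?_ (((i2.add i3).sub (i4.add i1)).congr heq) zero_le_one ?_
    · filter_upwards [hpos] with ω ⟨h1, h2, h3, h4⟩
      exact div_pos (mul_pos h2 h3) (mul_pos h4 h1)
    have hUle : ∀ x z w, ENNReal.ofReal (f x) * ENNReal.ofReal (U (x, z, w)) ≤
        ENNReal.ofReal (g (x + z + w - z)) *
          (ENNReal.ofReal (r (x + z)) / ENNReal.ofReal (s (x + z + w))) := by
      intro x z w
      have hxzw : x + z + w - z = x + w := by abel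
      rw [hxzw]
      rcases (hf.nonneg x).eq_or_lt with h0 | h0
      · simp [← h0]
      rcases (hs.nonneg (x + z + w)).eq_or_lt with h0' | h0'
      · simp [U, ← h0']
      rw [← ENNReal.ofReal_mul (hf.nonneg x), ← ENNReal.ofReal_div_of_pos h0',
        ← ENNReal.ofReal_mul (hg.nonneg _)]
      refine ENNReal.ofReal_le_ofReal (le_of_eq ?_)
      simp only [U]
      field_simp
    have hrs : ∀ w, Measurable fun y => ENNReal.ofReal (r y) / ENNReal.ofReal (s (y + w)) :=
      fun w => hr.measurable.ennreal_ofReal.div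
        (hs.measurable.comp (measurable_id.add_const w)).ennreal_ofReal
    calc ∫⁻ ω, ENNReal.ofReal (U (X ω, Z ω, W ω)) ∂μ
        = ∫⁻ ω', ∫⁻ ω, ∫⁻ x, ENNReal.ofReal (f x) * ENNReal.ofReal (U (x, Z ω, W ω')) ∂volume ∂μ ∂μ :=
          htriple (fun p => ENNReal.ofReal (U p)) hU.ennreal_ofReal
      _ ≤ ∫⁻ ω', ∫⁻ ω, ∫⁻ x, ENNReal.ofReal (g (x + Z ω + W ω' - Z ω)) *
            (ENNReal.ofReal (r (x + Z ω)) / ENNReal.ofReal (s (x + Z ω + W ω'))) ∂volume ∂μ ∂μ :=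
          lintegral_mono fun ω' => lintegral_mono fun ω => lintegral_mono fun x => hUle _ _ _
      _ = ∫⁻ ω', ∫⁻ ω, ∫⁻ y, ENNReal.ofReal (g (y + W ω' - Z ω)) *
            (ENNReal.ofReal (r y) / ENNReal.ofReal (s (y + W ω'))) ∂volume ∂μ ∂μ := by
          refine lintegral_congr fun ω' => lintegral_congr fun ω => ?_
          exact lintegral_add_right_eq_self (fun y => ENNReal.ofReal (g (y + W ω' - Z ω)) *
            (ENNReal.ofReal (r y) / ENNReal.ofReal (s (y + W ω')))) (Z ω)
      _ = ∫⁻ ω', ∫⁻ y, (∫⁻ ω, ENNReal.ofReal (g (y + W ω' - Z ω)) ∂μ) *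
            (ENNReal.ofReal (r y) / ENNReal.ofReal (s (y + W ω'))) ∂volume ∂μ := by
          refine lintegral_congr fun ω' => ?_
          have hgm : Measurable fun p : Ω × E => ENNReal.ofReal (g (p.2 + W ω' - Z p.1)) :=
            (hg.measurable.comp (by fun_prop)).ennreal_ofReal
          rw [lintegral_lintegral_swap]
          · refine lintegral_congr fun y => ?_
            exact lintegral_mul_const _ (hgm.comp measurable_prodMk_right)
          · exact (hgm.mul ((hrs (W ω')).comp measurable_snd)).aemeasurable
      _ ≤ ∫⁻ ω', ∫⁻ y, ENNReal.ofReal (r y) ∂volume ∂μ := by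
          refine lintegral_mono fun ω' => lintegral_mono_ae ?_
          have hshift := (quasiMeasurePreserving_add_right (volume : Measure E) (W ω')).ae hconv
          filter_upwards [hshift] with y hy
          rw [← hy, ← mul_div_assoc, mul_comm, mul_div_assoc]
          exact mul_le_of_le_one_right' ENNReal.div_self_le_one
      _ = ENNReal.ofReal 1 := by
          simp [hr.lintegral_eq_one hXZ']
  have i23 : Integrable (fun ω => Real.log (g (X ω + W ω)) + Real.log (r (X ω + Z ω))) μ :=
    i2.add i3
  have i41 : Integrable (fun ω => Real.log (s (X ω + Z ω + W ω)) + Real.log (f (X ω))) μ :=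
    i4.add i1
  rw [← integral_congr_ae heq, integral_sub i23 i41, integral_add i2 i3,
    integral_add i4 i1, hf.integral_log hX, hg.integral_log hXW, hr.integral_log hXZ',
    hs.integral_log hS] at key
  linarith

/-- Upper semicontinuity at `0` of the entropy of `X + t C`, given a reference density `ρ` whose
logarithm varies slowly and is integrable along `X`. -/
theorem integral_mul_log_le_of_tendsto [IsProbabilityMeasure μ] {X C : Ω → E}
    (hX : Measurable X) (hC : Measurable C) {ρ : E → ℝ} (hρ : Measurable ρ) (hρ0 : ∀ x, 0 < ρ x)
    (hρ1 : ∫⁻ x, ENNReal.ofReal (ρ x) ≤ 1) {N : ℝ} (hN : 0 ≤ N)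
    (hρN : ∀ x y, |Real.log (ρ (x + y)) - Real.log (ρ x)| ≤ N * Real.log (1 + ‖y‖))
    (hClog : Integrable (fun ω => Real.log (1 + ‖C ω‖)) μ)
    (hXlog : Integrable (fun ω => Real.log (ρ (X ω))) μ)
    {f : E → ℝ} (hf : IsEntropyDensity f X μ) {F : ℝ → E → ℝ}
    (hF : ∀ t, 0 < t → IsEntropyDensity (F t) (fun ω => X ω + t • C ω) μ) {L : ℝ}
    (hL : Tendsto (fun t => ∫ x, F t x * Real.log (F t x)) (𝓝[>] 0) (𝓝 L)) :
    ∫ x, f x * Real.log (f x) ≤ L := by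
  have hρc : Continuous fun x => Real.log (ρ x) := by
    refine continuous_iff_continuousAt.2 fun x => ?_
    rw [ContinuousAt, tendsto_iff_dist_tendsto_zero]
    have h0 : Tendsto (fun z => N * Real.log (1 + ‖z - x‖)) (𝓝 x) (𝓝 0) := by
      have : ContinuousAt (fun z => N * Real.log (1 + ‖z - x‖)) x := by
        refine ContinuousAt.mul continuousAt_const (ContinuousAt.log (by fun_prop) ?_)
        simp
      simpa [ContinuousAt] using this
    refine squeeze_zero (fun _ => dist_nonneg) (fun z => ?_) h0
    simpa [Real.dist_eq] using hρN x (z - x)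
  have hShift : ∀ t : ℝ, Measurable fun ω => X ω + t • C ω := fun t => by fun_prop
  have hbound : ∀ t : ℝ, 0 < t → t ≤ 1 → ∀ ω,
      |Real.log (ρ (X ω + t • C ω))| ≤ |Real.log (ρ (X ω))| + N * Real.log (1 + ‖C ω‖) := by
    intro t ht ht1 ω
    have h1 := hρN (X ω) (t • C ω)
    have h2 : Real.log (1 + ‖t • C ω‖) ≤ Real.log (1 + ‖C ω‖) := by
      refine Real.log_le_log (by positivity) ?_
      rw [norm_smul, Real.norm_of_nonneg ht.le]
      nlinarith [norm_nonneg (C ω)]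
    have h3 := mul_le_mul_of_nonneg_left h2 hN
    have h4 := abs_sub_abs_le_abs_sub (Real.log (ρ (X ω + t • C ω))) (Real.log (ρ (X ω)))
    linarith
  -- comparison with a continuous perturbation of the reference density
  have hcont : ∀ (k : E → ℝ) (δ M m : ℝ), Continuous k → 0 < δ → (∀ x, δ ≤ k x) →
      (∀ x, k x ≤ M) → 0 ≤ m → ∫⁻ x, ENNReal.ofReal (ρ x * k x) ≤ ENNReal.ofReal m →
      ∫ ω, Real.log (ρ (X ω) * k (X ω)) ∂μ - L ≤ m - 1 := by
    intro k δ M m hk hδ hδk hkM hm hle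
    have hk0 : ∀ x, 0 < k x := fun x => hδ.trans_le (hδk x)
    have hmul : ∀ x, Real.log (ρ x * k x) = Real.log (ρ x) + Real.log (k x) := fun x =>
      Real.log_mul (hρ0 x).ne' (hk0 x).ne'
    have hlogk : ∀ x, |Real.log (k x)| ≤ |Real.log δ| + |Real.log M| := by
      intro x
      have h1 := Real.log_le_log hδ (hδk x)
      have h2 := Real.log_le_log (hk0 x) (hkM x)
      rw [abs_le]
      constructor
      · linarith [neg_abs_le (Real.log δ), abs_nonneg (Real.log M)]
      · linarith [le_abs_self (Real.log M), abs_nonneg (Real.log δ)]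
    have hkc : Continuous fun x => Real.log (ρ x * k x) := by
      simp_rw [hmul]
      exact hρc.add (hk.log fun x => (hk0 x).ne')
    have hbi : Integrable (fun ω => (|Real.log (ρ (X ω))| + N * Real.log (1 + ‖C ω‖)) +
        (|Real.log δ| + |Real.log M|)) μ :=
      (hXlog.abs.add (hClog.const_mul N)).add (integrable_const _)
    have hb : ∀ t : ℝ, 0 < t → t ≤ 1 → ∀ ω, ‖Real.log (ρ (X ω + t • C ω) * k (X ω + t • C ω))‖ ≤
        (|Real.log (ρ (X ω))| + N * Real.log (1 + ‖C ω‖)) + (|Real.log δ| + |Real.log M|) := by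
      intro t ht ht1 ω
      rw [hmul, Real.norm_eq_abs]
      exact (abs_add_le _ _).trans (add_le_add (hbound t ht ht1 ω) (hlogk _))
    have hev : ∀ᶠ t : ℝ in 𝓝[>] 0, 0 < t ∧ t ≤ 1 :=
      Ioc_mem_nhdsGT zero_lt_one
    have hlim : Tendsto (fun t : ℝ => ∫ ω, Real.log (ρ (X ω + t • C ω) * k (X ω + t • C ω)) ∂μ)
        (𝓝[>] 0) (𝓝 (∫ ω, Real.log (ρ (X ω) * k (X ω)) ∂μ)) := by
      refine tendsto_integral_filter_of_dominated_convergence _ ?_ ?_ hbi ?_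
      · exact Eventually.of_forall fun t =>
          (hkc.measurable.comp (hShift t)).aestronglyMeasurable
      · exact hev.mono fun t ht => ae_of_all _ (hb t ht.1 ht.2)
      · refine ae_of_all _ fun ω => ?_
        have : Continuous fun t : ℝ => Real.log (ρ (X ω + t • C ω) * k (X ω + t • C ω)) :=
          hkc.comp (by fun_prop)
        simpa using (this.tendsto 0).mono_left nhdsWithin_le_nhds
    refine le_of_tendsto (hlim.sub hL) (hev.mono fun t ht => ?_)
    rw [← (hF t ht.1).integral_log (hShift t)]
    refine (hF t ht.1).integral_log_le (hShift t) (ρ := fun x => ρ x * k x)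
      (hρ.mul hk.measurable) (fun x => mul_pos (hρ0 x) (hk0 x)) ?_ hm hle
    exact hbi.mono' (hkc.measurable.comp (hShift t)).aestronglyMeasurable
      (ae_of_all _ (hb t ht.1 ht.2))
  have : IsProbabilityMeasure (μ.map X) := Measure.isProbabilityMeasure_map hX.aemeasurable
  have : IsFiniteMeasure ((volume : Measure E).withDensity (fun x => ENNReal.ofReal (ρ x))) :=
    isFiniteMeasure_withDensity (hρ1.trans_lt ENNReal.one_lt_top).ne
  -- the same comparison for a bounded measurable perturbation
  have hmeas : ∀ (k : E → ℝ) (δ M m : ℝ), Measurable k → 0 < δ → (∀ x, δ ≤ k x) →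
      (∀ x, k x ≤ M) → 0 ≤ m → ∫⁻ x, ENNReal.ofReal (ρ x * k x) ≤ ENNReal.ofReal m →
      ∫ ω, Real.log (ρ (X ω)) ∂μ + ∫ ω, Real.log (k (X ω)) ∂μ - L ≤ m - 1 := by
    intro k δ M m hk hδ hδk hkM hm hle
    have hk0 : ∀ x, 0 < k x := fun x => hδ.trans_le (hδk x)
    have hlogint : ∀ k' : E → ℝ, Measurable k' → (∀ x, δ ≤ k' x) → (∀ x, k' x ≤ M) →
        Integrable (fun ω => Real.log (k' (X ω))) μ := by
      intro k' hk' h1 h2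
      refine Integrable.of_bound (hk'.comp hX).log.aestronglyMeasurable
        (|Real.log δ| + |Real.log M|) (ae_of_all _ fun ω => ?_)
      have h3 := Real.log_le_log hδ (h1 (X ω))
      have h4 := Real.log_le_log (hδ.trans_le (h1 (X ω))) (h2 (X ω))
      rw [Real.norm_eq_abs, abs_le]
      constructor
      · linarith [neg_abs_le (Real.log δ), abs_nonneg (Real.log M)]
      · linarith [le_abs_self (Real.log M), abs_nonneg (Real.log δ)]
    have happrox : ∀ η : ℝ, 0 < η →
        ∫ ω, Real.log (ρ (X ω)) ∂μ + ∫ ω, Real.log (k (X ω)) ∂μ - L ≤ m - 1 + (η + η / δ) := by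
      intro η hη
      set τ := (volume : Measure E).withDensity (fun x => ENNReal.ofReal (ρ x)) + μ.map X
        with hτ
      have hkint : Integrable k τ := by
        refine Integrable.of_bound hk.aestronglyMeasurable M (ae_of_all _ fun x => ?_)
        rw [Real.norm_of_nonneg (hk0 x).le]
        exact hkM x
      obtain ⟨κ, hκ, -⟩ := hkint.exists_boundedContinuous_lintegral_sub_le
        (ε := ENNReal.ofReal η) (by simpa using hη)
      let k' : E → ℝ := fun x => max δ (min (κ x) M)
      have hk'c : Continuous k' := continuous_const.max (κ.continuous.min continuous_const)
      have hk'δ : ∀ x, δ ≤ k' x := fun x => le_max_left _ _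
      have hδM : δ ≤ M := (hδk 0).trans (hkM 0)
      have hk'M : ∀ x, k' x ≤ M := fun x => max_le hδM (min_le_right _ _)
      have hkk' : ∀ x, |k x - k' x| ≤ |k x - κ x| := by
        intro x
        have h1 : k x = max δ (min (k x) M) := by
          rw [min_eq_left (hkM x), max_eq_right (hδk x)]
        calc |k x - k' x| = |max δ (min (k x) M) - max δ (min (κ x) M)| := by rw [← h1]
          _ ≤ |min (k x) M - min (κ x) M| := by
              simpa using abs_max_sub_max_le_max δ (min (k x) M) δ (min (κ x) M)
          _ ≤ |k x - κ x| := by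
              simpa using abs_min_sub_min_le_max (k x) M (κ x) M
      have hkk'm : Measurable fun x => ENNReal.ofReal |k x - k' x| :=
        (hk.sub hk'c.measurable).abs.ennreal_ofReal
      have hτle : ∫⁻ x, ENNReal.ofReal |k x - k' x| ∂τ ≤ ENNReal.ofReal η := by
        refine (lintegral_mono fun x => ?_).trans hκ
        rw [Real.enorm_eq_ofReal_abs]
        exact ENNReal.ofReal_le_ofReal (hkk' x)
      rw [hτ, lintegral_add_measure] at hτle
      have h1 : ∫⁻ x, ENNReal.ofReal (ρ x) * ENNReal.ofReal |k x - k' x| ≤ ENNReal.ofReal η := by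
        refine le_trans (le_of_eq ?_) (le_self_add.trans hτle)
        rw [lintegral_withDensity_eq_lintegral_mul _ hρ.ennreal_ofReal hkk'm]
        rfl
      have habs : AEStronglyMeasurable (fun ω => |k (X ω) - k' (X ω)|) μ :=
        ((hk.comp hX).sub (hk'c.measurable.comp hX)).abs.aestronglyMeasurable
      have h2 : ∫ ω, |k (X ω) - k' (X ω)| ∂μ ≤ η := by
        have h3 : ∫⁻ ω, ENNReal.ofReal |k (X ω) - k' (X ω)| ∂μ ≤ ENNReal.ofReal η := by
          rw [← lintegral_map hkk'm hX]
          exact le_add_self.trans hτle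
        rw [integral_eq_lintegral_of_nonneg_ae (ae_of_all _ fun ω => abs_nonneg _) habs]
        exact ENNReal.toReal_le_of_le_ofReal hη.le h3
      have h2i : Integrable (fun ω => |k (X ω) - k' (X ω)|) μ := by
        refine Integrable.of_bound habs (M - δ) (ae_of_all _ fun ω => ?_)
        rw [Real.norm_eq_abs, abs_abs, abs_le]
        constructor <;> linarith [hδk (X ω), hkM (X ω), hk'δ (X ω), hk'M (X ω)]
      have hik := hlogint k hk hδk hkM
      have hik' := hlogint k' hk'c.measurable hk'δ hk'M
      have h4 : ∫ ω, Real.log (k (X ω)) ∂μ - ∫ ω, Real.log (k' (X ω)) ∂μ ≤ η / δ := by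
        rw [← integral_sub hik hik']
        calc ∫ ω, (Real.log (k (X ω)) - Real.log (k' (X ω))) ∂μ
            ≤ ∫ ω, |k (X ω) - k' (X ω)| / δ ∂μ := by
              refine integral_mono (hik.sub hik') (h2i.div_const δ) fun ω => ?_
              have ha := hk0 (X ω)
              have hb : 0 < k' (X ω) := hδ.trans_le (hk'δ _)
              calc Real.log (k (X ω)) - Real.log (k' (X ω))
                  = Real.log (k (X ω) / k' (X ω)) := (Real.log_div ha.ne' hb.ne').symm
                _ ≤ k (X ω) / k' (X ω) - 1 := Real.log_le_sub_one_of_pos (div_pos ha hb)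
                _ = (k (X ω) - k' (X ω)) / k' (X ω) := by field_simp
                _ ≤ |k (X ω) - k' (X ω)| / k' (X ω) := by gcongr; exact le_abs_self _
                _ ≤ |k (X ω) - k' (X ω)| / δ := by gcongr; exact hk'δ _
          _ = (∫ ω, |k (X ω) - k' (X ω)| ∂μ) / δ := integral_div _ _
          _ ≤ η / δ := by gcongr
      have h5 : ∫⁻ x, ENNReal.ofReal (ρ x * k' x) ≤ ENNReal.ofReal (m + η) := by
        rw [ENNReal.ofReal_add hm hη.le]
        refine le_trans ?_ (add_le_add hle h1)
        have hρk : Measurable fun x => ENNReal.ofReal (ρ x * k x) := (hρ.mul hk).ennreal_ofReal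
        rw [← lintegral_add_left hρk]
        refine lintegral_mono fun x => ?_
        rw [← ENNReal.ofReal_mul (hρ0 x).le, ← ENNReal.ofReal_add
          (mul_pos (hρ0 x) (hk0 x)).le (mul_nonneg (hρ0 x).le (abs_nonneg _)), ← mul_add]
        refine ENNReal.ofReal_le_ofReal (mul_le_mul_of_nonneg_left ?_ (hρ0 x).le)
        linarith [neg_abs_le (k x - k' x)]
      have h6 := hcont k' δ M (m + η) hk'c hδ hk'δ hk'M (by linarith) h5
      have h7 : ∫ ω, Real.log (ρ (X ω) * k' (X ω)) ∂μ =
          ∫ ω, Real.log (ρ (X ω)) ∂μ + ∫ ω, Real.log (k' (X ω)) ∂μ := by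
        rw [← integral_add hXlog hik']
        refine integral_congr_ae (ae_of_all _ fun ω => ?_)
        exact Real.log_mul (hρ0 _).ne' (hδ.trans_le (hk'δ _)).ne'
      linarith
    have hlim : Tendsto (fun η : ℝ => m - 1 + (η + η / δ)) (𝓝[>] 0) (𝓝 (m - 1)) := by
      have : Continuous fun η : ℝ => m - 1 + (η + η / δ) := by fun_prop
      simpa using (this.tendsto 0).mono_left nhdsWithin_le_nhds
    exact ge_of_tendsto hlim (eventually_mem_nhdsWithin.mono happrox)
  -- truncations of the likelihood ratio `f / ρ`
  let K : ℕ → E → ℝ := fun n x => max ((n : ℝ) + 1)⁻¹ (min (f x / ρ x) ((n : ℝ) + 1))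
  have hKm : ∀ n, Measurable (K n) := fun n =>
    measurable_const.max ((hf.measurable.div hρ).min measurable_const)
  have hone : ∀ n : ℕ, (1 : ℝ) ≤ (n : ℝ) + 1 := fun n => by linarith [(n.cast_nonneg : (0 : ℝ) ≤ n)]
  have hinv : ∀ n : ℕ, ((n : ℝ) + 1)⁻¹ ≤ 1 := fun n => inv_le_one_of_one_le₀ (hone n)
  have hKle : ∀ n : ℕ, ∫ ω, Real.log (ρ (X ω)) ∂μ + ∫ ω, Real.log (K n (X ω)) ∂μ - L ≤
      (1 + ((n : ℝ) + 1)⁻¹) - 1 := by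
    intro n
    have hpos : 0 < ((n : ℝ) + 1)⁻¹ := by positivity
    refine hmeas (K n) ((n : ℝ) + 1)⁻¹ ((n : ℝ) + 1) _ (hKm n) hpos (fun x => le_max_left _ _)
      (fun x => max_le ((hinv n).trans (hone n)) (min_le_right _ _)) (by positivity) ?_
    calc ∫⁻ x, ENNReal.ofReal (ρ x * K n x)
        ≤ ∫⁻ x, (ENNReal.ofReal (f x) + ENNReal.ofReal ((n : ℝ) + 1)⁻¹ * ENNReal.ofReal (ρ x)) := by
          refine lintegral_mono fun x => ?_
          rw [← ENNReal.ofReal_mul hpos.le, ← ENNReal.ofReal_add (hf.nonneg x)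
            (mul_pos hpos (hρ0 x)).le]
          refine ENNReal.ofReal_le_ofReal ?_
          have h1 : K n x ≤ f x / ρ x + ((n : ℝ) + 1)⁻¹ := by
            have := div_nonneg (hf.nonneg x) (hρ0 x).le
            refine max_le (by linarith) ((min_le_left _ _).trans (by linarith))
          calc ρ x * K n x ≤ ρ x * (f x / ρ x + ((n : ℝ) + 1)⁻¹) :=
                mul_le_mul_of_nonneg_left h1 (hρ0 x).le
            _ = f x + ((n : ℝ) + 1)⁻¹ * ρ x := by
                have := (hρ0 x).ne'
                field_simp
      _ ≤ 1 + ENNReal.ofReal ((n : ℝ) + 1)⁻¹ * 1 := by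
          rw [lintegral_add_left hf.measurable.ennreal_ofReal,
            lintegral_const_mul _ hρ.ennreal_ofReal, hf.lintegral_eq_one hX]
          gcongr
      _ = ENNReal.ofReal (1 + ((n : ℝ) + 1)⁻¹) := by
          rw [ENNReal.ofReal_add zero_le_one hpos.le, ENNReal.ofReal_one, mul_one]
  have hflog := hf.integrable_log hX
  have hKlim : Tendsto (fun n => ∫ ω, Real.log (K n (X ω)) ∂μ) atTop
      (𝓝 (∫ ω, (Real.log (f (X ω)) - Real.log (ρ (X ω))) ∂μ)) := by
    refine tendsto_integral_of_dominated_convergence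
      (fun ω => |Real.log (f (X ω)) - Real.log (ρ (X ω))|)
      (fun n => ((hKm n).comp hX).log.aestronglyMeasurable) (hflog.sub hXlog).abs ?_ ?_
    · intro n
      filter_upwards [hf.ae_pos hX] with ω hω
      have hr : 0 < f (X ω) / ρ (X ω) := div_pos hω (hρ0 _)
      rw [← Real.log_div hω.ne' (hρ0 _).ne', Real.norm_eq_abs]
      have hn : 0 < ((n : ℝ) + 1)⁻¹ := by positivity
      simp only [K]
      rcases le_total (f (X ω) / ρ (X ω)) 1 with h1 | h1
      · rw [min_eq_left (h1.trans (hone n)), abs_of_nonpos, abs_of_nonpos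
          (Real.log_nonpos hr.le h1)]
        · exact neg_le_neg (Real.log_le_log hr (le_max_right _ _))
        · exact Real.log_nonpos (hn.le.trans (le_max_left _ _)) (max_le (hinv n) h1)
      · have h2 : 1 ≤ min (f (X ω) / ρ (X ω)) ((n : ℝ) + 1) := le_min h1 (hone n)
        rw [max_eq_right ((hinv n).trans h2), abs_of_nonneg (Real.log_nonneg h2),
          abs_of_nonneg (Real.log_nonneg h1)]
        exact Real.log_le_log (by linarith) (min_le_left _ _)
    · filter_upwards [hf.ae_pos hX] with ω hω
      have hr : 0 < f (X ω) / ρ (X ω) := div_pos hω (hρ0 _)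
      rw [← Real.log_div hω.ne' (hρ0 _).ne']
      refine tendsto_const_nhds.congr' ?_
      have t1 : Tendsto (fun n : ℕ => (n : ℝ) + 1) atTop atTop :=
        tendsto_natCast_atTop_atTop.atTop_add tendsto_const_nhds
      filter_upwards [t1.eventually_ge_atTop (f (X ω) / ρ (X ω)),
        t1.inv_tendsto_atTop.eventually_le_const hr] with n h1 h2
      have h3 : ((n : ℝ) + 1)⁻¹ ≤ f (X ω) / ρ (X ω) := h2
      simp only [K]
      rw [min_eq_left h1, max_eq_right h3]
  have hfin := le_of_tendsto_of_tendsto' ((hKlim.const_add (∫ ω, Real.log (ρ (X ω)) ∂μ)).sub_const L)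
    ((tendsto_inv_atTop_zero.comp (tendsto_natCast_atTop_atTop.atTop_add
      (tendsto_const_nhds (x := (1 : ℝ))))).const_add 1 |>.sub_const 1) hKle
  rw [integral_sub hflog hXlog, hf.integral_log hX] at hfin
  linarith

end Density

section Cauchy

variable {d : ℕ}

theorem pC_pos (x : EuclideanSpace ℝ (Fin d)) : 0 < pC d x := by
  have h1 : 0 < Real.Gamma (((d : ℝ) + 1) / 2) := Real.Gamma_pos_of_pos (by positivity)
  have h2 : 0 < Real.pi ^ (-((d : ℝ) + 1) / 2) := Real.rpow_pos_of_pos Real.pi_pos _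
  have h3 : 0 < (1 + ‖x‖ ^ 2) ^ (-((d : ℝ) + 1) / 2) := Real.rpow_pos_of_pos (by positivity) _
  exact mul_pos (mul_pos h1 h2) h3

theorem continuous_pC : Continuous (pC d) := by
  refine continuous_const.mul (Continuous.rpow_const (by fun_prop) fun x => Or.inl ?_)
  positivity

theorem log_pC (x : EuclideanSpace ℝ (Fin d)) :
    Real.log (pC d x) = Real.log (pC d 0) - ((d : ℝ) + 1) / 2 * Real.log (1 + ‖x‖ ^ 2) := by
  have h1 : 0 < Real.Gamma (((d : ℝ) + 1) / 2) := Real.Gamma_pos_of_pos (by positivity)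
  have h2 : 0 < Real.pi ^ (-((d : ℝ) + 1) / 2) := Real.rpow_pos_of_pos Real.pi_pos _
  have h3 : 0 < (1 + ‖x‖ ^ 2) ^ (-((d : ℝ) + 1) / 2) := Real.rpow_pos_of_pos (by positivity) _
  have h0 : pC d 0 = Real.Gamma (((d : ℝ) + 1) / 2) * Real.pi ^ (-((d : ℝ) + 1) / 2) := by
    simp [pC]
  rw [h0, pC, Real.log_mul (mul_pos h1 h2).ne' h3.ne', Real.log_rpow (by positivity)]
  ring

theorem pC_le_pC_zero (x : EuclideanSpace ℝ (Fin d)) : pC d x ≤ pC d 0 := by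
  rw [← Real.log_le_log_iff (pC_pos x) (pC_pos 0), log_pC x]
  have : 0 ≤ Real.log (1 + ‖x‖ ^ 2) := Real.log_nonneg (by nlinarith [sq_nonneg ‖x‖])
  have := mul_nonneg (by positivity : (0 : ℝ) ≤ ((d : ℝ) + 1) / 2) this
  linarith

/-- Harnack inequality for the Cauchy density. -/
theorem pC_le_mul_pC_add (u y : EuclideanSpace ℝ (Fin d)) :
    pC d u ≤ Real.exp (((d : ℝ) + 1) * Real.log (1 + ‖y‖)) * pC d (u + y) := by
  rw [← Real.log_le_log_iff (pC_pos u) (mul_pos (Real.exp_pos _) (pC_pos _)),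
    Real.log_mul (Real.exp_pos _).ne' (pC_pos _).ne', Real.log_exp, log_pC u, log_pC (u + y)]
  have hy := norm_nonneg y
  have hu := norm_nonneg u
  have h1 : 1 + ‖u + y‖ ^ 2 ≤ (1 + ‖u‖ ^ 2) * (1 + ‖y‖) ^ 2 := by
    have h2 : ‖u + y‖ ^ 2 ≤ (‖u‖ + ‖y‖) ^ 2 := by gcongr; exact norm_add_le _ _
    nlinarith [mul_nonneg hy (sq_nonneg (‖u‖ - 1)), mul_nonneg (sq_nonneg ‖u‖) (sq_nonneg ‖y‖),
      mul_nonneg hu hy]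
  have h2 := Real.log_le_log (by positivity) h1
  rw [Real.log_mul (by positivity) (by positivity), Real.log_pow] at h2
  push_cast at h2
  have h3 := mul_le_mul_of_nonneg_left h2 (by positivity : (0 : ℝ) ≤ ((d : ℝ) + 1) / 2)
  linarith

theorem integrable_pC_mul_log :
    Integrable fun x : EuclideanSpace ℝ (Fin d) => pC d x * Real.log (1 + ‖x‖) := by
  have h1 : Integrable fun x : EuclideanSpace ℝ (Fin d) =>
      pC d 0 * (2 ^ (((d : ℝ) + 1) / 2) * 2) * (1 + ‖x‖) ^ (-((d : ℝ) + 1 / 2)) :=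
    (integrable_one_add_norm (by simp)).const_mul _
  have hcont : Continuous fun x : EuclideanSpace ℝ (Fin d) => pC d x * Real.log (1 + ‖x‖) :=
    continuous_pC.mul (Continuous.log (by fun_prop) fun x => by positivity)
  refine h1.mono' hcont.aestronglyMeasurable (ae_of_all _ fun x => ?_)
  have hx := norm_nonneg x
  have hlog : 0 ≤ Real.log (1 + ‖x‖) := Real.log_nonneg (by linarith)
  rw [Real.norm_of_nonneg (mul_nonneg (pC_pos x).le hlog)]
  have h2 : Real.log (1 + ‖x‖) ≤ (1 + ‖x‖) ^ (1 / 2 : ℝ) / (1 / 2) :=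
    Real.log_le_rpow_div (by positivity) (by norm_num)
  have h3 : (1 + ‖x‖ ^ 2) ^ (-((d : ℝ) + 1) / 2) ≤
      2 ^ (((d : ℝ) + 1) / 2) * (1 + ‖x‖) ^ (-((d : ℝ) + 1)) :=
    rpow_neg_one_add_norm_sq_le x (by positivity)
  have h4 : pC d x = pC d 0 * (1 + ‖x‖ ^ 2) ^ (-((d : ℝ) + 1) / 2) := by simp [pC]
  have h5 : (1 + ‖x‖) ^ (-((d : ℝ) + 1 / 2)) =
      (1 + ‖x‖) ^ (-((d : ℝ) + 1)) * (1 + ‖x‖) ^ (1 / 2 : ℝ) := by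
    rw [← Real.rpow_add (by positivity)]
    congr 1
    ring
  have h0 := (pC_pos (d := d) 0).le
  calc pC d x * Real.log (1 + ‖x‖)
      ≤ (pC d 0 * (2 ^ (((d : ℝ) + 1) / 2) * (1 + ‖x‖) ^ (-((d : ℝ) + 1)))) *
        ((1 + ‖x‖) ^ (1 / 2 : ℝ) / (1 / 2)) := by
        rw [h4]
        gcongr
    _ = _ := by
        rw [h5]
        ring

variable {Ω : Type*} [MeasurableSpace Ω] {μ : Measure Ω} {C : Ω → EuclideanSpace ℝ (Fin d)}

theorem integrable_log_one_add_norm_of_map_eq (hC : Measurable C)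
    (hClaw : μ.map C = volume.withDensity (fun x => ENNReal.ofReal (pC d x))) :
    Integrable (fun ω => Real.log (1 + ‖C ω‖)) μ := by
  have : Integrable (fun x => Real.log (1 + ‖x‖)) (μ.map C) := by
    rw [hClaw, integrable_withDensity_iff_integrable_smul'
      continuous_pC.measurable.ennreal_ofReal (ae_of_all _ fun _ => ENNReal.ofReal_lt_top)]
    simpa only [ENNReal.toReal_ofReal (pC_pos _).le, smul_eq_mul] using integrable_pC_mul_log
  exact this.comp_measurable hC

theorem volume_absolutelyContinuous_map_of_map_eq
    (hClaw : μ.map C = volume.withDensity (fun x => ENNReal.ofReal (pC d x))) :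
    volume ≪ μ.map C := by
  rw [hClaw]
  refine withDensity_absolutelyContinuous' continuous_pC.measurable.ennreal_ofReal.aemeasurable
    (ae_of_all _ fun x => ?_)
  simpa using pC_pos x

/-- The density of `X + C` for a Cauchy vector `C` independent of `X`. -/
noncomputable def cauchyConv (μ : Measure Ω) (X : Ω → EuclideanSpace ℝ (Fin d))
    (x : EuclideanSpace ℝ (Fin d)) : ℝ :=
  ∫ ω, pC d (x - X ω) ∂μ

variable [IsProbabilityMeasure μ] {X : Ω → EuclideanSpace ℝ (Fin d)}

theorem integrable_pC_sub (hX : Measurable X) (x : EuclideanSpace ℝ (Fin d)) :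
    Integrable (fun ω => pC d (x - X ω)) μ := by
  refine Integrable.of_bound
    (continuous_pC.measurable.comp (measurable_const.sub hX)).aestronglyMeasurable (pC d 0)
    (ae_of_all _ fun ω => ?_)
  rw [Real.norm_of_nonneg (pC_pos _).le]
  exact pC_le_pC_zero _

theorem measurable_cauchyConv (hX : Measurable X) : Measurable (cauchyConv μ X) := by
  have : Measurable fun p : EuclideanSpace ℝ (Fin d) × Ω => pC d (p.1 - X p.2) :=
    continuous_pC.measurable.comp (measurable_fst.sub (hX.comp measurable_snd))
  exact (this.stronglyMeasurable.integral_prod_right).measurable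

theorem cauchyConv_pos (hX : Measurable X) (x : EuclideanSpace ℝ (Fin d)) :
    0 < cauchyConv μ X x := by
  rw [cauchyConv, integral_pos_iff_support_of_nonneg (fun ω => (pC_pos _).le)
    (integrable_pC_sub hX x)]
  have : Function.support (fun ω => pC d (x - X ω)) = Set.univ :=
    Set.eq_univ_of_forall fun ω => (pC_pos _).ne'
  simp [this]

theorem ofReal_cauchyConv (hX : Measurable X) (x : EuclideanSpace ℝ (Fin d)) :
    ENNReal.ofReal (cauchyConv μ X x) = ∫⁻ ω, ENNReal.ofReal (pC d (x - X ω)) ∂μ :=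
  ofReal_integral_eq_lintegral_ofReal (integrable_pC_sub hX x) (ae_of_all _ fun _ => (pC_pos _).le)

theorem cauchyConv_le (hX : Measurable X) (x y : EuclideanSpace ℝ (Fin d)) :
    cauchyConv μ X x ≤
      Real.exp (((d : ℝ) + 1) * Real.log (1 + ‖y‖)) * cauchyConv μ X (x + y) := by
  rw [cauchyConv, cauchyConv, ← integral_const_mul]
  refine integral_mono (integrable_pC_sub hX x) ((integrable_pC_sub hX _).const_mul _) fun ω => ?_
  have := pC_le_mul_pC_add (x - X ω) y
  rwa [sub_add_eq_add_sub] at this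

theorem abs_log_cauchyConv_sub_le (hX : Measurable X) (x y : EuclideanSpace ℝ (Fin d)) :
    |Real.log (cauchyConv μ X (x + y)) - Real.log (cauchyConv μ X x)| ≤
      ((d : ℝ) + 1) * Real.log (1 + ‖y‖) := by
  have key : ∀ a b : EuclideanSpace ℝ (Fin d), Real.log (cauchyConv μ X a) ≤
      ((d : ℝ) + 1) * Real.log (1 + ‖b‖) + Real.log (cauchyConv μ X (a + b)) := by
    intro a b
    have h := Real.log_le_log (cauchyConv_pos hX a) (cauchyConv_le (μ := μ) hX a b)
    rwa [Real.log_mul (Real.exp_pos _).ne' (cauchyConv_pos hX _).ne', Real.log_exp] at h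
  have h1 := key x y
  have h2 := key (x + y) (-y)
  rw [norm_neg, add_neg_cancel_right] at h2
  rw [abs_le]
  constructor <;> linarith

theorem map_add_eq_withDensity_cauchyConv (hX : Measurable X) (hC : Measurable C)
    (hXC : IndepFun X C μ)
    (hClaw : μ.map C = volume.withDensity (fun x => ENNReal.ofReal (pC d x))) :
    μ.map (fun ω => X ω + C ω) =
      volume.withDensity (fun x => ENNReal.ofReal (cauchyConv μ X x)) := by
  have hpC : Measurable fun x => ENNReal.ofReal (pC d x) := continuous_pC.measurable.ennreal_ofReal
  have hdens : (fun x => ENNReal.ofReal (cauchyConv μ X x)) =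
      fun x => ∫⁻ ω, ENNReal.ofReal (pC d (x - X ω)) ∂μ := funext (ofReal_cauchyConv hX)
  rw [hdens]
  refine map_eq_withDensity_of_lintegral (T := fun ω => X ω + C ω)
    (a := fun x => ENNReal.ofReal (pC d x)) (hX.add hC) hX hpC fun k hk => ?_
  have hk2 : Measurable fun p : EuclideanSpace ℝ (Fin d) × EuclideanSpace ℝ (Fin d) =>
      k (p.2 + p.1) := hk.comp (measurable_snd.add measurable_fst)
  rw [lintegral_comp_of_indepFun (k := fun p => k (p.2 + p.1)) hC hX hXC.symm hk2]
  refine lintegral_congr fun ω => ?_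
  have hkω : Measurable fun x => k (X ω + x) := hk.comp (measurable_const.add measurable_id)
  rw [← lintegral_map hkω hC, hClaw, lintegral_withDensity_eq_lintegral_mul _ hpC hkω]
  simp only [Pi.mul_apply, add_comm]

/-- Upper semicontinuity at `0` of the entropy of `X + t C`, with `C` Cauchy. -/
theorem integral_mul_log_le_of_tendsto_cauchy (hX : Measurable X) (hC : Measurable C)
    (hXC : IndepFun X C μ)
    (hClaw : μ.map C = volume.withDensity (fun x => ENNReal.ofReal (pC d x)))
    {f : EuclideanSpace ℝ (Fin d) → ℝ} (hf : IsEntropyDensity f X μ)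
    {F : ℝ → EuclideanSpace ℝ (Fin d) → ℝ}
    (hF : ∀ t, 0 < t → IsEntropyDensity (F t) (fun ω => X ω + t • C ω) μ) {L : ℝ}
    (hL : Tendsto (fun t => ∫ x, F t x * Real.log (F t x)) (𝓝[>] 0) (𝓝 L)) :
    ∫ x, f x * Real.log (f x) ≤ L := by
  have hρ : Measurable (cauchyConv μ X) := measurable_cauchyConv hX
  have hmap := map_add_eq_withDensity_cauchyConv hX hC hXC hClaw
  have hClog := integrable_log_one_add_norm_of_map_eq hC hClaw
  have hF1 : IsEntropyDensity (F 1) (fun ω => X ω + C ω) μ := by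
    simpa only [one_smul] using hF 1 one_pos
  have hae : F 1 =ᵐ[volume] cauchyConv μ X := by
    have h1 := hF1.map_eq.symm.trans hmap
    have h2 := (withDensity_eq_iff_of_sigmaFinite hF1.measurable.ennreal_ofReal.aemeasurable
      hρ.ennreal_ofReal.aemeasurable).1 h1
    filter_upwards [h2] with x hx
    exact (ENNReal.ofReal_eq_ofReal_iff (hF1.nonneg x) (cauchyConv_pos hX x).le).1 hx
  have hρd : IsEntropyDensity (cauchyConv μ X) (fun ω => X ω + C ω) μ := by
    refine ⟨hρ, fun x => (cauchyConv_pos hX x).le, hmap, hF1.integrable.congr ?_⟩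
    filter_upwards [hae] with x hx
    rw [hx]
  have hN : (0 : ℝ) ≤ (d : ℝ) + 1 := by positivity
  have hXlog : Integrable (fun ω => Real.log (cauchyConv μ X (X ω))) μ := by
    refine ((hρd.integrable_log (hX.add hC)).abs.add (hClog.const_mul ((d : ℝ) + 1))).mono'
      (hρ.comp hX).log.aestronglyMeasurable (ae_of_all _ fun ω => ?_)
    have h1 := abs_log_cauchyConv_sub_le (μ := μ) hX (X ω) (C ω)
    have h2 := abs_sub_abs_le_abs_sub (Real.log (cauchyConv μ X (X ω)))
      (Real.log (cauchyConv μ X (X ω + C ω)))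
    rw [abs_sub_comm] at h2
    simp only [Real.norm_eq_abs, Pi.add_apply]
    linarith
  exact integral_mul_log_le_of_tendsto hX hC hρ (cauchyConv_pos hX)
    (hρd.lintegral_eq_one (hX.add hC)).le hN (abs_log_cauchyConv_sub_le hX) hClog hXlog hf hF hL

end Cauchy

/-- A function with a finite right difference quotient limit at `0` is right continuous there. -/
theorem tendsto_of_tendsto_sub_div {u : ℝ → ℝ} {J : ℝ}
    (h : Tendsto (fun t => ((-u t) - (-u 0)) / t) (𝓝[>] 0) (𝓝 J)) :
    Tendsto u (𝓝[>] 0) (𝓝 (u 0)) := by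
  have hid : Tendsto (fun t : ℝ => t) (𝓝[>] 0) (𝓝 0) := nhdsWithin_le_nhds
  have h1 := (h.mul hid).const_sub (u 0)
  rw [mul_zero, sub_zero] at h1
  refine h1.congr' (eventually_mem_nhdsWithin.mono fun t ht => ?_)
  have : t ≠ 0 := ne_of_gt ht
  field_simp
  ring

/-- Genuine densities realising the entropies of a family of densities with full support. -/
theorem exists_isEntropyDensity_family {Ω : Type*} [MeasurableSpace Ω] {μ : Measure Ω} {d : ℕ}
    {Y : ℝ → Ω → EuclideanSpace ℝ (Fin d)} {q : ℝ → EuclideanSpace ℝ (Fin d) → ℝ}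
    (hq : ∀ t : ℝ, 0 ≤ t → μ.map (Y t) = volume.withDensity (fun x => ENNReal.ofReal (q t x)))
    (hent : ∀ t : ℝ, 0 ≤ t → Integrable (fun x => q t x * Real.log (q t x)))
    (hac : ∀ t : ℝ, 0 < t → volume ≪ μ.map (Y t)) :
    ∃ f : ℝ → EuclideanSpace ℝ (Fin d) → ℝ, (∀ t, 0 ≤ t → IsEntropyDensity (f t) (Y t) μ) ∧
      ∀ t, 0 < t → ∫ x, f t x * Real.log (f t x) = ∫ x, q t x * Real.log (q t x) := by
  choose! f hf hfq using fun t ht => exists_isEntropyDensity (hq t ht) (hent t ht)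
  refine ⟨f, hf, fun t ht => integral_congr_ae ?_⟩
  filter_upwards [hfq t ht.le, (hf t ht.le).ae_pos_of_absolutelyContinuous (hac t ht)] with x h1 h2
  exact h1 h2.ne'

/-- Property (6) of the `α`-Fisher information at `α = 1`: adding an independent
random vector cannot increase the `α`-Fisher information, `J₁(X+Z) ≤ J₁(X)`. -/
theorem stmt12 (d : ℕ)
    {Ω : Type} [MeasurableSpace Ω] (μ : Measure Ω) [IsProbabilityMeasure μ]
    (X Z C : Ω → EuclideanSpace ℝ (Fin d))
    (hX : Measurable X) (hZ : Measurable Z) (hC : Measurable C)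
    (hXZ : IndepFun X Z μ)
    (hCindep : IndepFun (fun ω => (X ω, Z ω)) C μ)
    (hClaw : Measure.map C μ = volume.withDensity (fun x => ENNReal.ofReal (pC d x)))
    (q r : ℝ → EuclideanSpace ℝ (Fin d) → ℝ)
    (hq : ∀ t : ℝ, 0 ≤ t → Measure.map (fun ω => X ω + t • C ω) μ =
        volume.withDensity (fun x => ENNReal.ofReal (q t x)))
    (hr : ∀ t : ℝ, 0 ≤ t → Measure.map (fun ω => X ω + Z ω + t • C ω) μ =
        volume.withDensity (fun x => ENNReal.ofReal (r t x)))
    (hentq : ∀ t : ℝ, 0 ≤ t → Integrable (fun x => q t x * Real.log (q t x)))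
    (hentr : ∀ t : ℝ, 0 ≤ t → Integrable (fun x => r t x * Real.log (r t x)))
    (JX JXZ : ℝ)
    (hJX : Tendsto (fun t : ℝ =>
        ((-∫ x, q t x * Real.log (q t x)) - (-∫ x, q 0 x * Real.log (q 0 x))) / t)
      (nhdsWithin 0 (Set.Ioi 0)) (nhds JX))
    (hJXZ : Tendsto (fun t : ℝ =>
        ((-∫ x, r t x * Real.log (r t x)) - (-∫ x, r 0 x * Real.log (r 0 x))) / t)
      (nhdsWithin 0 (Set.Ioi 0)) (nhds JXZ)) :
    JXZ ≤ JX := by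
  have hXC : IndepFun X C μ := hCindep.comp measurable_fst measurable_id
  have hXZC : IndepFun (fun ω => X ω + Z ω) C μ :=
    hCindep.comp (measurable_fst.add measurable_snd) measurable_id
  have hac := volume_absolutelyContinuous_map_of_map_eq hClaw
  have hacs : ∀ t : ℝ, 0 < t → volume ≪ μ.map (fun ω => t • C ω) := fun t ht =>
    volume_absolutelyContinuous_map_smul hC hac ht.ne'
  have hsm : ∀ t : ℝ, Measurable fun x : EuclideanSpace ℝ (Fin d) => t • x := fun t => by fun_prop
  have htC : ∀ t : ℝ, Measurable fun ω => t • C ω := fun t => hC.const_smul t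
  obtain ⟨f, hf, hfq⟩ := exists_isEntropyDensity_family hq hentq fun t ht =>
    volume_absolutelyContinuous_map_add (htC t) hX
      (hXC.comp measurable_id (hsm t)).symm (hacs t ht)
  obtain ⟨g, hg, hgr⟩ := exists_isEntropyDensity_family hr hentr fun t ht =>
    volume_absolutelyContinuous_map_add (htC t) (hX.add hZ)
      (hXZC.comp measurable_id (hsm t)).symm (hacs t ht)
  have hf0 : IsEntropyDensity (f 0) X μ := by
    simpa only [zero_smul, add_zero] using hf 0 le_rfl
  have hg0 : IsEntropyDensity (g 0) (fun ω => X ω + Z ω) μ := by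
    simpa only [zero_smul, add_zero] using hg 0 le_rfl
  have hql := tendsto_of_tendsto_sub_div (u := fun t => ∫ x, q t x * Real.log (q t x)) hJX
  have hrl := tendsto_of_tendsto_sub_div (u := fun t => ∫ x, r t x * Real.log (r t x)) hJXZ
  have hfl : ∫ x, f 0 x * Real.log (f 0 x) ≤ ∫ x, q 0 x * Real.log (q 0 x) :=
    integral_mul_log_le_of_tendsto_cauchy hX hC hXC hClaw hf0 (fun t ht => hf t ht.le)
      (hql.congr' (eventually_mem_nhdsWithin.mono fun t ht => (hfq t ht).symm))
  have hgl : ∫ x, r 0 x * Real.log (r 0 x) ≤ ∫ x, g 0 x * Real.log (g 0 x) := by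
    refine le_of_tendsto hrl (eventually_mem_nhdsWithin.mono fun t ht => ?_)
    rw [← hgr t ht]
    exact integral_log_add_le (hX.add hZ) (htC t) (hXZC.comp measurable_id (hsm t)) hg0
      (hg t (le_of_lt ht))
  refine le_of_tendsto_of_tendsto hJXZ hJX (eventually_mem_nhdsWithin.mono fun t ht => ?_)
  have hmain := integral_log_sub_le hX hZ (htC t) hXZ (hCindep.comp measurable_id (hsm t)) hf0
    (hf t (le_of_lt ht)) hg0 (hg t (le_of_lt ht))
  rw [hfq t ht, hgr t ht] at hmain
  refine div_le_div_of_nonneg_right ?_ (le_of_lt ht)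
  linarith
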